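/- Let (c, s) solve the initial value problem IVP on the open disc B_r(0) with r = 2^(-2/3), so that s takes values in the open unit disc. Then for every z in B_r(0), the integral of dσ/(1 - σ^3)^(2/3) along the straight segment from 0 to s(z) equals z; that is, the integral over t from 0 to 1 of s(z) · (1 - (t·s(z))^3)^(-2/3) dt equals z, where the power is principal-valued. -/

import Mathlib

open Complex Metric Set intervalIntegral

/-- A function with zero derivative on a ball around `0` is constant there. -/
theorem eq_value_zero_of_hasDerivAt_zero {f : ℂ → ℂ} {r : ℝ}
    (hf : ∀ z ∈ ball (0 : ℂ) r, HasDerivAt f 0 z) {z : ℂ} (hz : z ∈ ball (0 : ℂ) r) :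
    f z = f 0 := by
  have h0 : (0 : ℂ) ∈ ball (0 : ℂ) r := mem_ball_self (pos_of_mem_ball hz)
  exact isOpen_ball.is_const_of_deriv_eq_zero (convex_ball 0 r).isPreconnected
    (fun x hx => (hf x hx).differentiableAt.differentiableWithinAt)
    (fun x hx => (hf x hx).deriv) hz h0

theorem one_sub_cube_mem_slitPlane {w : ℂ} (hw : ‖w‖ < 1) : 1 - w ^ 3 ∈ slitPlane := by
  rw [sub_eq_add_neg]
  apply mem_slitPlane_of_norm_lt_one
  rw [norm_neg, norm_pow]
  exact pow_lt_one₀ (norm_nonneg _) hw (by norm_num)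

section IVP

variable {r : ℝ} {c s : ℂ → ℂ}

theorem cube_add_cube_eq_one (hc0 : c 0 = 1) (hs0 : s 0 = 0)
    (hderiv : ∀ z ∈ ball (0 : ℂ) r,
      HasDerivAt c (-(s z) ^ 2) z ∧ HasDerivAt s ((c z) ^ 2) z)
    {z : ℂ} (hz : z ∈ ball (0 : ℂ) r) : c z ^ 3 + s z ^ 3 = 1 := by
  have key := eq_value_zero_of_hasDerivAt_zero (f := fun z => c z ^ 3 + s z ^ 3) (r := r)
    (fun w hw => by
      obtain ⟨h1, h2⟩ := hderiv w hw
      refine ((h1.fun_pow 3).fun_add (h2.fun_pow 3)).congr_deriv ?_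
      push_cast
      ring) hz
  simpa [hc0, hs0] using key

/-- On the disc of radius `r` with `4 r ^ 3 = 1`, the sine component stays in the unit disc. -/
theorem norm_lt_one_of_ivp (hr0 : 0 < r) (hr3 : 4 * r ^ 3 = 1) (hc0 : c 0 = 1) (hs0 : s 0 = 0)
    (hderiv : ∀ z ∈ ball (0 : ℂ) r,
      HasDerivAt c (-(s z) ^ 2) z ∧ HasDerivAt s ((c z) ^ 2) z)
    {z : ℂ} (hz : z ∈ ball (0 : ℂ) r) : ‖s z‖ < 1 := by
  rcases eq_or_ne z 0 with rfl | hz0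
  · simp [hs0]
  have hzr : ‖z‖ < r := by simpa using hz
  have hzpos : 0 < ‖z‖ := norm_pos_iff.mpr hz0
  have hk1 : ‖z‖ / r < 1 := (div_lt_one hr0).mpr hzr
  have hk0 : 0 < ‖z‖ / r := by positivity
  have hmem : ∀ t ∈ Icc (0 : ℝ) 1, (t : ℂ) * z ∈ ball (0 : ℂ) r := by
    intro t ht
    rw [mem_ball_zero_iff, norm_mul, norm_real, Real.norm_of_nonneg ht.1]
    nlinarith [ht.2]
  have hd : ∀ t ∈ Icc (0 : ℝ) 1,
      HasDerivAt (fun t : ℝ => s ((t : ℂ) * z)) (c ((t : ℂ) * z) ^ 2 * z) t := by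
    intro t ht
    have h1 : HasDerivAt (fun w : ℂ => w * z) z (t : ℂ) := by
      simpa using (hasDerivAt_id (t : ℂ)).mul_const z
    exact ((hderiv _ (hmem t ht)).2.comp (t : ℂ) h1).comp_ofReal
  have key := image_norm_le_of_norm_deriv_right_lt_deriv_boundary
    (f := fun t : ℝ => s ((t : ℂ) * z)) (a := 0) (b := 1)
    (B := fun t => ‖z‖ / r * t) (B' := fun _ => ‖z‖ / r)
    (fun t ht => (hd t ht).continuousAt.continuousWithinAt)
    (fun t ht => (hd t (Ico_subset_Icc_self ht)).hasDerivWithinAt)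
    (by simp [hs0])
    (fun t => by simpa using (hasDerivAt_id t).const_mul (‖z‖ / r))
    (by
      intro t ht hst
      have hcs := cube_add_cube_eq_one hc0 hs0 hderiv (hmem t (Ico_subset_Icc_self ht))
      have hs1 : ‖s ((t : ℂ) * z)‖ < 1 := by
        rw [hst]
        nlinarith [ht.1, ht.2]
      have hc3 : ‖c ((t : ℂ) * z)‖ ^ 3 < 2 := by
        rw [← norm_pow, eq_sub_of_add_eq hcs]
        have h1 := norm_sub_le (1 : ℂ) (s ((t : ℂ) * z) ^ 3)
        rw [norm_one, norm_pow] at h1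
        have h2 := pow_lt_one₀ (norm_nonneg _) hs1 (three_ne_zero)
        linarith
      have hcr : ‖c ((t : ℂ) * z)‖ ^ 2 * r < 1 := by
        refine lt_of_pow_lt_pow_left₀ 3 zero_le_one ?_
        have h3 : (‖c ((t : ℂ) * z)‖ ^ 2 * r) ^ 3 = (‖c ((t : ℂ) * z)‖ ^ 3) ^ 2 * r ^ 3 := by ring
        have h4 : (‖c ((t : ℂ) * z)‖ ^ 3) ^ 2 < 2 ^ 2 :=
          pow_lt_pow_left₀ hc3 (by positivity) two_ne_zero
        rw [h3]
        nlinarith [pow_pos hr0 3]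
      rw [norm_mul, norm_pow, lt_div_iff₀ hr0]
      nlinarith)
    (right_mem_Icc.mpr zero_le_one)
  simp only [ofReal_one, one_mul, mul_one] at key
  exact key.trans_lt hk1

/-- The principal branch of `(1 - s ^ 3) ^ (-2/3)` is the reciprocal of `c ^ 2`. -/
theorem cpow_mul_sq_eq_one (hc0 : c 0 = 1) (hs0 : s 0 = 0)
    (hderiv : ∀ z ∈ ball (0 : ℂ) r,
      HasDerivAt c (-(s z) ^ 2) z ∧ HasDerivAt s ((c z) ^ 2) z)
    (hs1 : ∀ z ∈ ball (0 : ℂ) r, ‖s z‖ < 1)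
    {z : ℂ} (hz : z ∈ ball (0 : ℂ) r) :
    (1 - s z ^ 3) ^ (-(2 / 3) : ℂ) * c z ^ 2 = 1 := by
  have key := eq_value_zero_of_hasDerivAt_zero
    (f := fun z => (1 - s z ^ 3) ^ (-(2 / 3) : ℂ) * c z ^ 2) (r := r)
    (fun w hw => by
      obtain ⟨h1, h2⟩ := hderiv w hw
      have hsl := one_sub_cube_mem_slitPlane (hs1 w hw)
      have hne := slitPlane_ne_zero hsl
      have hcs := cube_add_cube_eq_one hc0 hs0 hderiv hw
      refine ((((h2.fun_pow 3).const_sub 1).cpow_const hsl).fun_mul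
        (h1.fun_pow 2)).congr_deriv ?_
      rw [cpow_sub _ _ hne, cpow_one]
      field_simp
      push_cast
      linear_combination (6 * (1 - s w ^ 3) ^ (-(2 / 3) : ℂ) * s w ^ 2 * c w) * hcs) hz
  simpa [hc0, hs0] using key

end IVP

theorem integral_segment_eq_sub {f F : ℂ → ℂ} {w : ℂ} {R : ℝ} (hw : w ∈ ball (0 : ℂ) R)
    (hf : ContinuousOn f (ball (0 : ℂ) R)) (hF : ∀ z ∈ ball (0 : ℂ) R, HasDerivAt F (f z) z) :
    ∫ t in (0 : ℝ)..1, w * f ((t : ℂ) * w) = F w - F 0 := by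
  have hmem : ∀ t ∈ uIcc (0 : ℝ) 1, (t : ℂ) * w ∈ ball (0 : ℂ) R := by
    intro t ht
    rw [uIcc_of_le zero_le_one] at ht
    rw [mem_ball_zero_iff] at hw ⊢
    rw [norm_mul, norm_real, Real.norm_of_nonneg ht.1]
    nlinarith [ht.2, norm_nonneg w]
  have h := integral_eq_sub_of_hasDerivAt (a := 0) (b := 1)
    (f := fun t : ℝ => F ((t : ℂ) * w)) (f' := fun t : ℝ => w * f ((t : ℂ) * w))
    (fun t ht => by
      have h1 : HasDerivAt (fun z : ℂ => z * w) w (t : ℂ) := by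
        simpa using (hasDerivAt_id (t : ℂ)).mul_const w
      exact ((hF _ (hmem t ht)).comp (t : ℂ) h1).comp_ofReal.congr_deriv (mul_comm _ _))
    (ContinuousOn.intervalIntegrable
      (continuousOn_const.mul (hf.comp (by fun_prop) hmem)))
  simpa using h

/-- If `(c, s)` solves the IVP on `B_r(0)`, `r = 2^(-2/3)`, then for
every `z` in the disc, `∫_0^1 s z * (1 - (t * s z)^3)^(-2/3) dt = z`
(principal-valued power). -/
theorem dixon_integral_formula (r : ℝ) (hr : r = (2:ℝ) ^ (-(2/3) : ℝ)) (c s : ℂ → ℂ)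
    (hc0 : c 0 = 1) (hs0 : s 0 = 0)
    (hderiv : ∀ z ∈ Metric.ball (0:ℂ) r,
      HasDerivAt c (-(s z) ^ 2) z ∧ HasDerivAt s ((c z) ^ 2) z) :
    ∀ z ∈ Metric.ball (0:ℂ) r,
      (∫ t in (0:ℝ)..1, s z * (1 - ((t : ℂ) * s z) ^ 3) ^ (-(2/3) : ℂ)) = z := by
  intro z hz
  have hr0 : 0 < r := hr ▸ Real.rpow_pos_of_pos two_pos _
  have hr3 : 4 * r ^ 3 = 1 := by
    have h : r ^ 3 = (2 : ℝ) ^ (-2 : ℝ) := by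
      rw [hr, ← Real.rpow_natCast, ← Real.rpow_mul two_pos.le]
      norm_num
    rw [h, Real.rpow_neg two_pos.le, Real.rpow_two]
    norm_num
  have hs1 : ∀ z ∈ ball (0 : ℂ) r, ‖s z‖ < 1 := fun z hz =>
    norm_lt_one_of_ivp hr0 hr3 hc0 hs0 hderiv hz
  have hf : DifferentiableOn ℂ (fun w : ℂ => (1 - w ^ 3) ^ (-(2 / 3) : ℂ)) (ball 0 1) := by
    intro w hw
    exact (((hasDerivAt_pow 3 w).const_sub 1).cpow_const (one_sub_cube_mem_slitPlane
      (mem_ball_zero_iff.mp hw))).differentiableAt.differentiableWithinAt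
  obtain ⟨F, hF⟩ := hf.isExactOn_ball
  rw [integral_segment_eq_sub (mem_ball_zero_iff.mpr (hs1 z hz)) hf.continuousOn hF]
  have key := eq_value_zero_of_hasDerivAt_zero (f := fun z => F (s z) - z)
    (fun w hw => by
      have h1 := (hF (s w) (mem_ball_zero_iff.mpr (hs1 w hw))).comp w (hderiv w hw).2
      refine (h1.sub (hasDerivAt_id w)).congr_deriv ?_
      rw [cpow_mul_sq_eq_one hc0 hs0 hderiv hs1 hw, sub_self]) hz
  simp only [hs0, sub_zero] at key
  linear_combination key
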